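/- If (μ, ν, σ) is a regular triple of standard Weyl pairs, then the space of all linear maps F : ℂ^N → ℂ^N ⊗ ℂ^N ⊗ ℂ^N satisfying F∘X_{μνσ} = (X_μ⊗X_ν⊗X_σ)∘F and F∘Y_{μνσ} = (X_μ^{-1}⊗X_ν^{-1}⊗Y_σ + X_μ^{-1}⊗Y_ν⊗Id + Y_μ⊗Id⊗Id)∘F has dimension exactly N^2. -/

import Mathlib

open TensorProduct

noncomputable section

/-- ℂ^N: functions from ℤ/Nℤ to ℂ. -/
abbrev CN (N : ℕ) := ZMod N → ℂ

/-- The operator A with A e_k = q^{2k} e_k. -/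
def opA (q : ℂ) (N : ℕ) : Module.End ℂ (CN N) where
  toFun f := fun k => q ^ (2 * k.val) * f k
  map_add' f g := by funext k; simp [mul_add]
  map_smul' c f := by funext k; simp [smul_eq_mul]; ring

/-- The operator B with B e_k = e_{k+1}. -/
def opB (N : ℕ) : Module.End ℂ (CN N) where
  toFun f := fun k => f (k - 1)
  map_add' f g := by funext k; simp
  map_smul' c f := by funext k; simp

/-- The operator C with C e_k = q^{1-2k} e_{k-1}, i.e. (C f)(k) = q^{-1-2k} f(k+1). -/
def opC (q : ℂ) (N : ℕ) : Module.End ℂ (CN N) where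
  toFun f := fun k => q ^ (-1 - 2 * (k.val : ℤ)) * f (k + 1)
  map_add' f g := by funext k; simp [mul_add]
  map_smul' c f := by funext k; simp [smul_eq_mul]; ring

/-- A Weyl pair: invertible endomorphisms with X Y = q² Y X. -/
def IsWeylPair (q : ℂ) {V : Type*} [AddCommMonoid V] [Module ℂ V]
    (X Y : Module.End ℂ V) : Prop :=
  IsUnit X ∧ IsUnit Y ∧ X * Y = q ^ 2 • (Y * X)

/-- A subspace invariant under both X and Y. -/
def WeylInvariant {V : Type*} [AddCommMonoid V] [Module ℂ V]
    (X Y : Module.End ℂ V) (W : Submodule ℂ V) : Prop :=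
  (∀ v ∈ W, X v ∈ W) ∧ (∀ v ∈ W, Y v ∈ W)

/-- An irreducible Weyl pair. -/
def IsIrreducibleWeylPair (q : ℂ) {V : Type*} [AddCommMonoid V] [Module ℂ V]
    (X Y : Module.End ℂ V) : Prop :=
  IsWeylPair q X Y ∧ Nontrivial V ∧
    ∀ W : Submodule ℂ V, WeylInvariant X Y W → W = ⊥ ∨ W = ⊤
/-- The space of linear maps ℂ^N → ℂ^N ⊗ ℂ^N ⊗ ℂ^N intertwining the Weyl pair
(Xp, Yp) with the triple tensor operators of (Xμ,Yμ), (Xν,Yν), (Xσ,Yσ). -/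
def CG3sub (N : ℕ) (Xμ Yμ Xν Yν Xσ Yσ Xp Yp : Module.End ℂ (CN N)) :
    Submodule ℂ (CN N →ₗ[ℂ] (CN N ⊗[ℂ] (CN N ⊗[ℂ] CN N))) where
  carrier := {F | F ∘ₗ Xp = (TensorProduct.map Xμ (TensorProduct.map Xν Xσ)) ∘ₗ F ∧
    F ∘ₗ Yp = (TensorProduct.map (Ring.inverse Xμ) (TensorProduct.map (Ring.inverse Xν) Yσ)
      + TensorProduct.map (Ring.inverse Xμ) (TensorProduct.map Yν 1)
      + TensorProduct.map Yμ 1) ∘ₗ F}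
  add_mem' := by
    rintro f g ⟨hf1, hf2⟩ ⟨hg1, hg2⟩
    constructor <;> simp only [LinearMap.add_comp, LinearMap.comp_add, hf1, hf2, hg1, hg2]
  zero_mem' := by constructor <;> simp
  smul_mem' := by
    rintro c f ⟨hf1, hf2⟩
    constructor <;> simp only [LinearMap.smul_comp, LinearMap.comp_smul, hf1, hf2]


theorem qcoef (ω : ℂ) (N : ℕ) (hω : IsPrimitiveRoot ω N) (hN : 1 ≤ N) :
    ∃ c : ℕ → ℕ → ℂ, (∀ n, c n 0 = 1) ∧ (∀ k, c 0 (k+1) = 0) ∧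
      (∀ n k, c (n+1) (k+1) = c n k + ω^(k+1) * c n (k+1)) ∧
      (∀ n k, n < k → c n k = 0) ∧ (∀ n, c n n = 1) ∧ ∀ k, 0 < k → k < N → c N k = 0 := by
  let c : ℕ → ℕ → ℂ := fun n => Nat.rec (fun k => if k = 0 then 1 else 0)
    (fun n ih k => Nat.casesOn k 1 (fun k => ih k + ω^(k+1) * ih (k+1))) n
  have h0 : ∀ n, c n 0 = 1 := by intro n; cases n <;> simp [c]
  have h1 : ∀ k, c 0 (k+1) = 0 := by intro k; simp [c]
  have h2 : ∀ n k, c (n+1) (k+1) = c n k + ω^(k+1) * c n (k+1) := fun n k => rfl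
  have h3 : ∀ n k, n < k → c n k = 0 := by
    intro n
    induction n with
    | zero => intro k hk; obtain ⟨k, rfl⟩ := Nat.exists_eq_succ_of_ne_zero hk.ne'; exact h1 k
    | succ n ih =>
      intro k hk
      obtain ⟨k, rfl⟩ := Nat.exists_eq_succ_of_ne_zero (by omega : k ≠ 0)
      rw [h2, ih k (by omega), ih (k+1) (by omega)]; simp
  have h4 : ∀ n, c n n = 1 := by
    intro n
    induction n with
    | zero => exact h0 0
    | succ n ih => rw [h2, ih, h3 n (n+1) (by omega)]; simp
  have h5 : ∀ n k, c n k * (ω^k - ω^n) = ω^k * (1 - ω^(k+1)) * c n (k+1) := by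
    intro n
    induction n with
    | zero =>
      intro k
      cases k with
      | zero => simp [h1]
      | succ k => simp [h1]
    | succ n ih =>
      intro k
      cases k with
      | zero =>
        rw [h2, h0, h0 (n+1)]; have := ih 0; rw [h0] at this
        simp only [pow_zero, zero_add, pow_one, one_mul] at *
        rw [pow_succ]; linear_combination ω * this
      | succ k =>
        rw [h2 n (k+1), h2 n k]
        have a := ih k
        have b := ih (k+1)
        simp only [pow_succ] at *
        linear_combination ω * a + ω * ω^k * ω * b
  refine ⟨c, h0, h1, h2, h3, h4, ?_⟩
  have hω0 : ω ≠ 0 := hω.ne_zero (by omega)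
  intro k
  induction k with
  | zero => intro h; omega
  | succ k ih =>
    intro _ hk
    have h := h5 N k
    have hl : c N k * (ω^k - ω^N) = 0 := by
      rcases Nat.eq_zero_or_pos k with rfl | hp
      · simp [hω.pow_eq_one]
      · simp [ih hp (by omega)]
    rw [hl] at h
    have hne : 1 - ω^(k+1) ≠ 0 := by
      intro hh
      have := (hω.pow_eq_one_iff_dvd (k+1)).1 (by linear_combination -hh)
      have := Nat.le_of_dvd (by omega) this
      omega
    simpa [hω0, hne] using h.symm

theorem qbinom {R : Type*} [Ring R] [Algebra ℂ R] (ω : ℂ) (N : ℕ) (hω : IsPrimitiveRoot ω N)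
    (hN : 1 ≤ N) (a b : R) (hab : a * b = ω • (b * a)) : (a + b)^N = a^N + b^N := by
  obtain ⟨c, h0, h1, h2, h3, h4, h5⟩ := qcoef ω N hω hN
  have hc : ∀ k, a * b^k = ω^k • (b^k * a) := by
    intro k
    induction k with
    | zero => simp
    | succ k ih =>
      rw [pow_succ, ← mul_assoc, ih, smul_mul_assoc, mul_assoc, hab, mul_smul_comm, smul_smul,
        ← mul_assoc, pow_succ]
  have key : ∀ n, (a + b)^n = ∑ k ∈ Finset.range (n+1), c n k • (b^k * a^(n-k)) := by
    intro n
    induction n with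
    | zero => simp [h0]
    | succ n ih =>
      rw [pow_succ', ih, add_mul, Finset.mul_sum, Finset.mul_sum, Finset.sum_range_succ' _ (n+1)]
      have e1 : ∑ k ∈ Finset.range (n+1), a * c n k • (b^k * a^(n-k))
          = ∑ k ∈ Finset.range (n+1), (ω^k * c n k) • (b^k * a^(n+1-k)) := by
        apply Finset.sum_congr rfl
        intro k hk
        rw [Finset.mem_range] at hk
        rw [mul_smul_comm, ← mul_assoc, hc, smul_mul_assoc, smul_smul, mul_assoc, ← pow_succ',
          mul_comm, show n + 1 - k = n - k + 1 by omega]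
      have e2 : ∑ k ∈ Finset.range (n+1), b * c n k • (b^k * a^(n-k))
          = ∑ k ∈ Finset.range (n+1), (c n k) • (b^(k+1) * a^(n+1-(k+1))) := by
        apply Finset.sum_congr rfl
        intro k hk
        rw [mul_smul_comm, ← mul_assoc, ← pow_succ', Nat.add_sub_add_right]
      have e3 : ∑ k ∈ Finset.range (n+1), (ω^k * c n k) • (b^k * a^(n+1-k))
         = ∑ k ∈ Finset.range (n+1), (ω^(k+1) * c n (k+1)) • (b^(k+1) * a^(n+1-(k+1)))
           + c (n+1) 0 • (b^0 * a^(n+1-0)) := by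
        rw [Finset.sum_range_succ', Finset.sum_range_succ, h3 n (n+1) (by omega), h0, h0]
        simp
      rw [e1, e2, e3, add_right_comm, ← Finset.sum_add_distrib]
      congr 1
      apply Finset.sum_congr rfl
      intro k hk
      rw [h2, add_smul, add_comm]
  obtain ⟨M, rfl⟩ := Nat.exists_eq_succ_of_ne_zero (by omega : N ≠ 0)
  rw [key, Finset.sum_range_succ, Finset.sum_range_succ', Finset.sum_eq_zero]
  · simp [h0, h4]
  · intro k hk
    rw [Finset.mem_range] at hk
    rw [h5 (k+1) (by omega) (by simpa using hk), zero_smul]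

def wEq (N : ℕ) {V : Type*} [AddCommGroup V] [Module ℂ V]
    (Xp Yp : Module.End ℂ (CN N)) (X Y : Module.End ℂ V) : Submodule ℂ (CN N →ₗ[ℂ] V) where
  carrier := {F | F ∘ₗ Xp = X ∘ₗ F ∧ F ∘ₗ Yp = Y ∘ₗ F}
  add_mem' := by
    rintro f g ⟨hf1, hf2⟩ ⟨hg1, hg2⟩
    constructor <;> simp only [LinearMap.add_comp, LinearMap.comp_add, hf1, hf2, hg1, hg2]
  zero_mem' := by constructor <;> simp
  smul_mem' := by
    rintro c f ⟨hf1, hf2⟩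
    constructor <;> simp only [LinearMap.smul_comp, LinearMap.comp_smul, hf1, hf2]

theorem opA_single (q : ℂ) (N : ℕ) [DecidableEq (ZMod N)] (k : ZMod N) :
    opA q N (Pi.single k 1) = (q^2)^k.val • (Pi.single k 1 : CN N) := by
  funext j
  by_cases h : j = k
  · subst h; simp [opA, pow_mul]
  · simp [opA, h]

theorem opB_single (N : ℕ) [DecidableEq (ZMod N)] (k : ZMod N) :
    opB N (Pi.single k 1) = (Pi.single (k+1) 1 : CN N) := by
  funext j
  simp [opB, Pi.single_apply, sub_eq_iff_eq_add]

theorem XYpow {R : Type*} [Ring R] [Algebra ℂ R] (ω : ℂ) (a b : R) (hab : a * b = ω • (b * a))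
    (k : ℕ) : a * b^k = ω^k • (b^k * a) := by
  induction k with
  | zero => simp
  | succ k ih =>
    rw [pow_succ, ← mul_assoc, ih, smul_mul_assoc, mul_assoc, hab, mul_smul_comm, smul_smul,
      ← mul_assoc, pow_succ]

theorem wEq_rank (N : ℕ) (hN : 1 ≤ N) (q u v : ℂ) (hv : v ≠ 0)
    {V : Type} [AddCommGroup V] [Module ℂ V]
    (X Y : Module.End ℂ V) (hXY : X * Y = q^2 • (Y * X)) (hY : Y^N = v^N • (1 : Module.End ℂ V)) :
    Module.rank ℂ (wEq N (u • opA q N) (v • opB N) X Y) = Module.rank ℂ (Module.End.eigenspace X u) := by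
  classical
  have : NeZero N := ⟨by omega⟩
  let ev : wEq N (u • opA q N) (v • opB N) X Y →ₗ[ℂ] Module.End.eigenspace X u :=
    LinearMap.codRestrict _ ((LinearMap.applyₗ (Pi.single 0 1 : CN N)) ∘ₗ Submodule.subtype _) (by
      rintro ⟨F, h1, h2⟩
      rw [Module.End.mem_eigenspace_iff]
      have := LinearMap.congr_fun h1 (Pi.single 0 1)
      simp only [LinearMap.comp_apply, LinearMap.smul_apply, opA_single] at this
      simpa using this.symm)
  refine (LinearEquiv.ofBijective ev ⟨?_, ?_⟩).rank_eq
  · rw [← LinearMap.ker_eq_bot, LinearMap.ker_eq_bot']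
    rintro ⟨F, h1, h2⟩ h0
    have h0' : F (Pi.single 0 1) = 0 := congrArg Subtype.val h0
    have hn : ∀ n : ℕ, F (Pi.single (n : ZMod N) 1) = 0 := by
      intro n
      induction n with
      | zero => simpa using h0'
      | succ n ih =>
        have := LinearMap.congr_fun h2 (Pi.single (n : ZMod N) 1)
        simp only [LinearMap.comp_apply, LinearMap.smul_apply, opB_single, ih, map_smul, map_zero] at this
        push_cast
        exact (smul_eq_zero.1 this).resolve_left hv
    ext1
    refine (Pi.basisFun ℂ (ZMod N)).ext fun k => ?_
    have := hn k.val
    rw [ZMod.natCast_zmod_val] at this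
    simpa using this
  · rintro ⟨w, hw⟩
    rw [Module.End.mem_eigenspace_iff] at hw
    let g : ℕ → V := fun n => (v⁻¹)^n • (Y^n) w
    have hg : Function.Periodic g N := by
      intro n
      simp only [g, pow_add, hY, Module.End.mul_apply, LinearMap.smul_apply, Module.End.one_apply,
        map_smul, smul_smul]
      congr 1
      rw [mul_assoc, ← mul_pow, inv_mul_cancel₀ hv, one_pow, mul_one]
    let F : CN N →ₗ[ℂ] V := (Pi.basisFun ℂ (ZMod N)).constr ℂ (fun k => g k.val)
    have hF : ∀ k, F (Pi.single k 1) = g k.val := by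
      intro k
      rw [← Pi.basisFun_apply]
      exact (Pi.basisFun ℂ (ZMod N)).constr_basis ℂ (fun k => g k.val) k
    refine ⟨⟨F, ?_, ?_⟩, ?_⟩
    · refine (Pi.basisFun ℂ (ZMod N)).ext fun k => ?_
      simp only [LinearMap.comp_apply, LinearMap.smul_apply, Pi.basisFun_apply, opA_single, map_smul, hF]
      have := LinearMap.congr_fun (XYpow (q^2) X Y hXY k.val) w
      simp only [Module.End.mul_apply, LinearMap.smul_apply, hw, map_smul] at this
      simp only [g, map_smul, this, smul_smul]
      congr 1; ring
    · refine (Pi.basisFun ℂ (ZMod N)).ext fun k => ?_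
      simp only [LinearMap.comp_apply, LinearMap.smul_apply, Pi.basisFun_apply, opB_single, map_smul, hF]
      have : g (k+1).val = g (k.val + 1) := by
        rw [← hg.map_mod_nat (k.val+1)]
        congr 1
        conv_lhs => rw [← ZMod.natCast_zmod_val k]
        rw [← Nat.cast_succ, ZMod.val_natCast]
      rw [this]
      simp only [g, map_smul, smul_smul, pow_succ', Module.End.mul_apply]
      congr 1
      field_simp
    · ext1
      change F (Pi.single 0 1) = w
      rw [hF]; simp [g]

theorem diag_rank {ι V : Type} [Fintype ι] [AddCommGroup V] [Module ℂ V] (b : Module.Basis ι ℂ V)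
    (T : Module.End ℂ V) (d : ι → ℂ) (hT : ∀ i, T (b i) = d i • b i) (u : ℂ) :
    Module.rank ℂ (Module.End.eigenspace T u) = Nat.card {i // d i = u} := by
  classical
  have hc : ∀ v i, b.repr (T v) i = d i * b.repr v i := by
    intro v i
    have : (Finsupp.lapply i ∘ₗ b.repr.toLinearMap ∘ₗ T) = d i • (Finsupp.lapply i ∘ₗ b.repr.toLinearMap) := by
      refine b.ext fun j => ?_
      by_cases h : j = i
      · subst h; simp [hT]
      · simp [hT, h]
    exact LinearMap.congr_fun this v
  let φ : Module.End.eigenspace T u →ₗ[ℂ] ({i // d i = u} → ℂ) :=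
    LinearMap.pi fun i => Finsupp.lapply i.1 ∘ₗ b.repr.toLinearMap ∘ₗ Submodule.subtype _
  have hb : Function.Bijective φ := by
    constructor
    · rw [← LinearMap.ker_eq_bot, LinearMap.ker_eq_bot']
      rintro ⟨w, hw⟩ h0
      rw [Module.End.mem_eigenspace_iff] at hw
      ext1
      apply b.repr.injective
      ext i
      by_cases h : d i = u
      · simpa [φ] using congrFun h0 ⟨i, h⟩
      · have := hc w i
        rw [hw] at this
        simp only [map_smul, Finsupp.smul_apply, smul_eq_mul] at this
        have h2 : (d i - u) * b.repr w i = 0 := by linear_combination -this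
        simpa [sub_ne_zero.2 h] using h2
    · intro f
      let w : V := b.equivFun.symm (fun i => if h : d i = u then f ⟨i, h⟩ else 0)
      have hw : ∀ i, b.repr w i = if h : d i = u then f ⟨i, h⟩ else 0 := by
        intro i
        rw [← b.equivFun_apply, LinearEquiv.apply_symm_apply]
      refine ⟨⟨w, ?_⟩, ?_⟩
      · rw [Module.End.mem_eigenspace_iff]
        apply b.repr.injective
        ext i
        rw [hc]
        simp only [map_smul, Finsupp.smul_apply, smul_eq_mul, hw]
        split_ifs with h <;> simp [h]
      · funext i
        change b.repr w i = f i
        rw [hw, dif_pos i.2]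
  rw [(LinearEquiv.ofBijective φ hb).rank_eq, rank_fun', Nat.card_eq_fintype_card]

theorem count (N : ℕ) (hN : 1 ≤ N) (ω : ℂ) (hω : IsPrimitiveRoot ω N) (u1 u2 u3 u : ℂ)
    (hu1 : u1 ≠ 0) (hu2 : u2 ≠ 0) (hu3 : u3 ≠ 0) (hx : u ^ N = u1 ^ N * u2 ^ N * u3 ^ N) :
    Nat.card {p : ZMod N × (ZMod N × ZMod N) //
      (u1 * ω^p.1.val) * ((u2 * ω^p.2.1.val) * (u3 * ω^p.2.2.val)) = u} = N^2 := by
  have : NeZero N := ⟨by omega⟩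
  have h0 : u1 * u2 * u3 ≠ 0 := by positivity
  obtain ⟨m, -, hm⟩ := hω.eq_pow_of_pow_eq_one (ξ := u / (u1*u2*u3)) (by
    rw [div_pow, hx, mul_pow, mul_pow, div_self (by positivity)])
  have hu : u = (u1*u2*u3) * ω^m := by rw [hm]; field_simp
  have key : ∀ p : ZMod N × (ZMod N × ZMod N),
      (u1 * ω^p.1.val) * ((u2 * ω^p.2.1.val) * (u3 * ω^p.2.2.val)) = u ↔
      p.2.2 = (m : ZMod N) - p.1 - p.2.1 := by
    rintro ⟨i, j, k⟩
    have e : (u1 * ω^i.val) * ((u2 * ω^j.val) * (u3 * ω^k.val))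
       = (u1*u2*u3) * ω^(i.val+j.val+k.val) := by ring
    simp only [e]
    rw [hu, mul_right_inj' h0]
    have : ω^(i.val+j.val+k.val) = ω^m ↔ (i.val+j.val+k.val) ≡ m [MOD N] := by
      rw [(hω.isOfFinOrder (by omega)).pow_eq_pow_iff_modEq, ← hω.eq_orderOf]
    rw [this, ← ZMod.natCast_eq_natCast_iff]
    push_cast
    simp only [ZMod.natCast_zmod_val]
    constructor <;> intro h
    · rw [← h]; ring
    · rw [h]; ring
  let e : {p : ZMod N × (ZMod N × ZMod N) //
      (u1 * ω^p.1.val) * ((u2 * ω^p.2.1.val) * (u3 * ω^p.2.2.val)) = u} ≃ ZMod N × ZMod N :=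
    { toFun := fun p => (p.1.1, p.1.2.1)
      invFun := fun r => ⟨(r.1, r.2, (m : ZMod N) - r.1 - r.2), (key _).2 rfl⟩
      left_inv := by
        rintro ⟨⟨i, j, k⟩, h⟩
        have := (key _).1 h
        simp only at this
        simp [this]
      right_inv := fun r => rfl }
  rw [Nat.card_congr e, Nat.card_prod, Nat.card_zmod, sq]

theorem std_facts (N : ℕ) (hN : 1 ≤ N) (q : ℂ) (hq : IsPrimitiveRoot (q ^ 2) N) (u v : ℂ)
    (hu : u ≠ 0) :
    IsUnit (u • opA q N) ∧
    (Ring.inverse (u • opA q N)) ^ N = (u^N)⁻¹ • (1 : Module.End ℂ (CN N)) ∧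
    (v • opB N) ^ N = v^N • (1 : Module.End ℂ (CN N)) ∧
    (u • opA q N) * (v • opB N) = q^2 • ((v • opB N) * (u • opA q N)) ∧
    Ring.inverse (u • opA q N) * (v • opB N)
      = (q^2)⁻¹ • ((v • opB N) * Ring.inverse (u • opA q N)) := by
  classical
  have : NeZero N := ⟨by omega⟩
  have hq0 : q^2 ≠ 0 := hq.ne_zero (by omega)
  have hAN : (u • opA q N)^N = u^N • (1 : Module.End ℂ (CN N)) := by
    rw [smul_pow]; congr 1
    refine (Pi.basisFun ℂ (ZMod N)).ext fun k => ?_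
    have : ∀ n : ℕ, (opA q N ^ n) (Pi.single k 1) = ((q^2)^k.val)^n • (Pi.single k 1 : CN N) := by
      intro n
      induction n with
      | zero => simp
      | succ n ih => rw [pow_succ', Module.End.mul_apply, ih, map_smul, opA_single, smul_smul, ← pow_succ]
    rw [Pi.basisFun_apply, this, ← pow_mul, mul_comm, pow_mul, hq.pow_eq_one]; simp
  have hBN : (v • opB N)^N = v^N • (1 : Module.End ℂ (CN N)) := by
    rw [smul_pow]; congr 1
    refine (Pi.basisFun ℂ (ZMod N)).ext fun k => ?_
    have : ∀ n : ℕ, (opB N ^ n) (Pi.single k 1) = (Pi.single (k+n) 1 : CN N) := by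
      intro n
      induction n with
      | zero => simp
      | succ n ih => rw [pow_succ', Module.End.mul_apply, ih, opB_single]; push_cast; rw [add_assoc]
    rw [Pi.basisFun_apply, this]; simp
  have hU : IsUnit (u • opA q N) := by
    rw [← isUnit_pow_iff (show N ≠ 0 by omega), hAN]
    rw [← Algebra.algebraMap_eq_smul_one]
    exact (IsUnit.mk0 (u^N) (by positivity)).map (algebraMap ℂ (Module.End ℂ (CN N)))
  have hc : (u • opA q N) * (v • opB N) = q^2 • ((v • opB N) * (u • opA q N)) := by
    have : opA q N * opB N = q^2 • (opB N * opA q N) := by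
      refine (Pi.basisFun ℂ (ZMod N)).ext fun k => ?_
      simp only [Pi.basisFun_apply, Module.End.mul_apply, LinearMap.smul_apply, opA_single, opB_single,
        map_smul, smul_smul]
      congr 1
      have hp : Function.Periodic (fun n : ℕ => (q^2)^n) N := by
        intro n; simp only [pow_add, hq.pow_eq_one, mul_one]
      have h2 : (k+1).val = (k.val+1) % N := by
        conv_lhs => rw [← ZMod.natCast_zmod_val k]
        rw [← Nat.cast_succ, ZMod.val_natCast]
      rw [h2, ← pow_succ']
      exact hp.map_mod_nat (k.val+1)
    simp only [smul_mul_assoc, mul_smul_comm, this, smul_smul]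
    congr 1; ring
  refine ⟨hU, ?_, hBN, hc, ?_⟩
  · have h1 := Ring.inverse_mul_cancel _ hU
    have h2 := Ring.mul_inverse_cancel _ hU
    have hcm : Commute (Ring.inverse (u • opA q N)) (u • opA q N) := h1.trans h2.symm
    have := hcm.mul_pow N
    rw [h1, one_pow, hAN, mul_smul_comm, mul_one] at this
    rw [this, smul_smul, inv_mul_cancel₀ (by positivity), one_smul]
  · set A := u • opA q N
    set B := v • opB N
    have h1 := Ring.inverse_mul_cancel _ hU
    have h2 := Ring.mul_inverse_cancel _ hU
    calc Ring.inverse A * B = Ring.inverse A * (B * A) * Ring.inverse A := by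
          rw [mul_assoc, mul_assoc, h2, mul_one]
      _ = Ring.inverse A * ((q^2)⁻¹ • (A * B)) * Ring.inverse A := by
          rw [hc, smul_smul, inv_mul_cancel₀ hq0, one_smul]
      _ = _ := by
          rw [mul_smul_comm, smul_mul_assoc, ← mul_assoc (Ring.inverse A), h1, one_mul]


/-- for a regular triple (μ, ν, σ) of standard Weyl pairs, the space
of equivariant maps ℂ^N → ℂ^N ⊗ ℂ^N ⊗ ℂ^N has dimension exactly N². -/
theorem stmt9 (N : ℕ) (hN : 1 ≤ N) (q : ℂ) (hq : IsPrimitiveRoot (q ^ 2) N)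
    (u1 v1 u2 v2 u3 v3 u123 v123 : ℂ)
    (hu1 : u1 ≠ 0) (hv1 : v1 ≠ 0) (hu2 : u2 ≠ 0) (hv2 : v2 ≠ 0)
    (hu3 : u3 ≠ 0) (hv3 : v3 ≠ 0) (hu123 : u123 ≠ 0) (hv123 : v123 ≠ 0)
    (hreg1 : (u1 ^ N)⁻¹ * v2 ^ N + v1 ^ N ≠ 0)
    (hreg2 : (u2 ^ N)⁻¹ * v3 ^ N + v2 ^ N ≠ 0)
    (hreg3 : (u1 ^ N * u2 ^ N)⁻¹ * v3 ^ N + (u1 ^ N)⁻¹ * v2 ^ N + v1 ^ N ≠ 0)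
    (hx : u123 ^ N = u1 ^ N * u2 ^ N * u3 ^ N)
    (hy : v123 ^ N = (u1 ^ N * u2 ^ N)⁻¹ * v3 ^ N + (u1 ^ N)⁻¹ * v2 ^ N + v1 ^ N) :
    Module.rank ℂ
      (CG3sub N (u1 • opA q N) (v1 • opB N) (u2 • opA q N) (v2 • opB N)
        (u3 • opA q N) (v3 • opB N) (u123 • opA q N) (v123 • opB N)) = (N ^ 2 : ℕ) := by
  classical
  have : NeZero N := ⟨by omega⟩
  have hω := hq.inv
  have hq0 : q^2 ≠ 0 := hq.ne_zero (by omega)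
  obtain ⟨U1, I1, B1, C1, D1⟩ := std_facts N hN q hq u1 v1 hu1
  obtain ⟨U2, I2, B2, C2, D2⟩ := std_facts N hN q hq u2 v2 hu2
  obtain ⟨U3, I3, B3, C3, D3⟩ := std_facts N hN q hq u3 v3 hu3
  have hA : ∀ (u : ℂ) (k : ZMod N), (u • opA q N) (Pi.single k 1) = (u * (q^2)^k.val) • (Pi.single k 1 : CN N) := by
    intro u k; rw [LinearMap.smul_apply, opA_single, smul_smul]
  have hdiag := diag_rank
    ((Pi.basisFun ℂ (ZMod N)).tensorProduct ((Pi.basisFun ℂ (ZMod N)).tensorProduct (Pi.basisFun ℂ (ZMod N))))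
    (TensorProduct.map (u1 • opA q N) (TensorProduct.map (u2 • opA q N) (u3 • opA q N)))
    (fun p => (u1 * (q^2)^p.1.val) * ((u2 * (q^2)^p.2.1.val) * (u3 * (q^2)^p.2.2.val)))
    (by
      rintro ⟨i, j, k⟩
      simp only [Module.Basis.tensorProduct_apply, TensorProduct.map_tmul, Pi.basisFun_apply, hA,
        TensorProduct.tmul_smul, ← TensorProduct.smul_tmul', smul_smul]
      try (congr 1; ring)) u123
  rw [count N hN (q^2) hq u1 u2 u3 u123 hu1 hu2 hu3 hx] at hdiag
  rw [← hdiag]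
  generalize u1 • opA q N = X1 at *
  generalize u2 • opA q N = X2 at *
  generalize u3 • opA q N = X3 at *
  generalize v1 • opB N = Y1 at *
  generalize v2 • opB N = Y2 at *
  generalize v3 • opB N = Y3 at *
  have m1 := Ring.inverse_mul_cancel _ U1
  have m1' := Ring.mul_inverse_cancel _ U1
  have m2 := Ring.inverse_mul_cancel _ U2
  have m2' := Ring.mul_inverse_cancel _ U2
  refine wEq_rank N hN q u123 v123 hv123 _ _ ?_ ?_
  · simp only [mul_add, add_mul, ← TensorProduct.map_mul, smul_add, C1, C2, C3, m1, m1', m2, m2', one_mul, mul_one,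
      TensorProduct.map_smul_left, TensorProduct.map_smul_right]
  · have c1 : TensorProduct.map (Ring.inverse X1) (TensorProduct.map (Ring.inverse X2) Y3)
        * TensorProduct.map (Ring.inverse X1) (TensorProduct.map Y2 1)
        = (q^2)⁻¹ • (TensorProduct.map (Ring.inverse X1) (TensorProduct.map Y2 1)
          * TensorProduct.map (Ring.inverse X1) (TensorProduct.map (Ring.inverse X2) Y3)) := by
      simp only [← TensorProduct.map_mul, D2, one_mul, mul_one,
        TensorProduct.map_smul_left, TensorProduct.map_smul_right]
    have c2 : (TensorProduct.map (Ring.inverse X1) (TensorProduct.map (Ring.inverse X2) Y3)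
        + TensorProduct.map (Ring.inverse X1) (TensorProduct.map Y2 1)) * TensorProduct.map Y1 1
        = (q^2)⁻¹ • (TensorProduct.map Y1 1 *
          (TensorProduct.map (Ring.inverse X1) (TensorProduct.map (Ring.inverse X2) Y3)
        + TensorProduct.map (Ring.inverse X1) (TensorProduct.map Y2 1))) := by
      simp only [mul_add, add_mul, smul_add, ← TensorProduct.map_mul, D1, one_mul, mul_one,
          TensorProduct.map_smul_left, TensorProduct.map_smul_right]
    have e2 := qbinom (R := Module.End ℂ (CN N ⊗[ℂ] (CN N ⊗[ℂ] CN N))) (q^2)⁻¹ N hω hN _ _ c2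
    have e1 := qbinom (R := Module.End ℂ (CN N ⊗[ℂ] (CN N ⊗[ℂ] CN N))) (q^2)⁻¹ N hω hN _ _ c1
    refine e2.trans ?_
    refine (congrArg (· + _) e1).trans ?_
    simp only [TensorProduct.map_pow, I1, I2, B1, B2, B3, one_pow,
      TensorProduct.map_smul_left, TensorProduct.map_smul_right, TensorProduct.map_one, smul_smul, ← add_smul]
    rw [hy]; congr 1; rw [mul_inv]; try ring

end
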